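/- Fix y ∈ 𝓨. If {x ∈ 𝓝^∞ : El(x,y) < +∞} ⊆ cl(dom₁Ef ∩ 𝓝^∞), where the closure is taken with respect to the essential-supremum norm on 𝓝^∞, and the restriction of El(·,y) to cl(dom₁Ef ∩ 𝓝^∞) is upper semicontinuous with respect to that norm, then φ̃*(y) = −inf_{x∈𝓝^∞} El(x,y). -/

import Mathlib

open MeasureTheory
open scoped ENNReal

noncomputable section

/-- The positive part of an extended real number, as an extended nonnegative real. -/
def epos (a : EReal) : ℝ≥0∞ := if a = ⊤ then ⊤ else ENNReal.ofReal a.toReal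

/-- Expectation of an extended-real-valued function: it equals `+∞` unless the positive
part is integrable, in which case it is the usual (possibly `-∞`) integral. -/
def EE {Ω : Type} [MeasurableSpace Ω] (P : Measure Ω) (φ : Ω → EReal) : EReal :=
  if ∫⁻ ω, epos (φ ω) ∂P = ⊤ then ⊤
  else ((∫⁻ ω, epos (φ ω) ∂P : ℝ≥0∞) : EReal) - ((∫⁻ ω, epos (-(φ ω)) ∂P : ℝ≥0∞) : EReal)

/-- `ℝ^n` viewed as `ℝ^{n_0} × ⋯ × ℝ^{n_T}`. -/
abbrev Vec {T : ℕ} (nt : Fin (T+1) → ℕ) : Type := (t : Fin (T+1)) → Fin (nt t) → ℝ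

/-- `x·v = Σ_t x_t·v_t`. -/
def dotN {T : ℕ} (nt : Fin (T+1) → ℕ) (a b : Vec nt) : ℝ := ∑ t, ∑ i, a t i * b t i

/-- The scalar product on `ℝ^m`. -/
def dotM {m : ℕ} (a b : Fin m → ℝ) : ℝ := ∑ j, a j * b j

variable {Ω : Type} [MeasurableSpace Ω] {T : ℕ} {nt : Fin (T+1) → ℕ} {m : ℕ}

/-- The space `𝓝` of adapted strategies. -/
def Nspace (nt : Fin (T+1) → ℕ) (ℱ : Fin (T+1) → MeasurableSpace Ω) :
    Set (Ω → Vec nt) := {x | ∀ t, Measurable[ℱ t] (fun ω => x ω t)}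

/-- The space `𝓝^∞` of essentially bounded adapted strategies. -/
def NspaceInf (nt : Fin (T+1) → ℕ) (ℱ : Fin (T+1) → MeasurableSpace Ω)
    (P : Measure Ω) : Set (Ω → Vec nt) :=
  {x | x ∈ Nspace nt ℱ ∧ ∃ M : ℝ, ∀ᵐ ω ∂P, ‖x ω‖ ≤ M}

/-- The annihilator `𝓝^⊥` of `𝓝^∞` in `L¹`. -/
def Nperp (nt : Fin (T+1) → ℕ) (ℱ : Fin (T+1) → MeasurableSpace Ω)
    (P : Measure Ω) : Set (Ω → Vec nt) :=
  {v | Measurable v ∧ Integrable v P ∧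
    ∀ x ∈ NspaceInf nt ℱ P, ∫ ω, dotN nt (x ω) (v ω) ∂P = 0}

/-- `Ef(x,u)`. -/
def intF (P : Measure Ω) (f : Vec nt → (Fin m → ℝ) → Ω → EReal)
    (x : Ω → Vec nt) (u : Ω → Fin m → ℝ) : EReal :=
  EE P (fun ω => f (x ω) (u ω) ω)

/-- The bilinear pairing `⟨u,y⟩ = E(u·y)`. -/
def pairing (P : Measure Ω) (u y : Ω → Fin m → ℝ) : ℝ := ∫ ω, dotM (u ω) (y ω) ∂P

/-- The value function `φ(u) = inf_{x∈𝓝} Ef(x,u)`. -/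
def valueFn (P : Measure Ω) (f : Vec nt → (Fin m → ℝ) → Ω → EReal)
    (ℱ : Fin (T+1) → MeasurableSpace Ω) (u : Ω → Fin m → ℝ) : EReal :=
  ⨅ x ∈ Nspace nt ℱ, intF P f x u

/-- The auxiliary value function `φ̃(u) = inf_{x∈𝓝^∞} Ef(x,u)`. -/
def valueFnInf (P : Measure Ω) (f : Vec nt → (Fin m → ℝ) → Ω → EReal)
    (ℱ : Fin (T+1) → MeasurableSpace Ω) (u : Ω → Fin m → ℝ) : EReal :=
  ⨅ x ∈ NspaceInf nt ℱ P, intF P f x u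

/-- The conjugate on `𝓨` of a function `g` on `𝓤`. -/
def conj (P : Measure Ω) (𝓤 : Set (Ω → Fin m → ℝ)) (g : (Ω → Fin m → ℝ) → EReal)
    (y : Ω → Fin m → ℝ) : EReal :=
  ⨆ u ∈ 𝓤, (((pairing P u y : ℝ) : EReal) - g u)

/-- The Lagrangian integrand `l(x,y,ω) = inf_u {f(x,u,ω) − u·y}`. -/
def lagr (f : Vec nt → (Fin m → ℝ) → Ω → EReal) (x : Vec nt) (y : Fin m → ℝ)
    (ω : Ω) : EReal :=
  ⨅ u : Fin m → ℝ, (f x u ω - ((dotM u y : ℝ) : EReal))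

/-- `El(x,y)`. -/
def intL (P : Measure Ω) (f : Vec nt → (Fin m → ℝ) → Ω → EReal)
    (x : Ω → Vec nt) (y : Ω → Fin m → ℝ) : EReal :=
  EE P (fun ω => lagr f (x ω) (y ω) ω)

/-- The pointwise conjugate `f*(v,y,ω)`. -/
def fconj (f : Vec nt → (Fin m → ℝ) → Ω → EReal) (v : Vec nt) (y : Fin m → ℝ)
    (ω : Ω) : EReal :=
  ⨆ x : Vec nt, ⨆ u : Fin m → ℝ, (((dotN nt x v + dotM u y : ℝ) : EReal) - f x u ω)

/-- `Ef*(v,y)`. -/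
def intFconj (P : Measure Ω) (f : Vec nt → (Fin m → ℝ) → Ω → EReal)
    (v : Ω → Vec nt) (y : Ω → Fin m → ℝ) : EReal :=
  EE P (fun ω => fconj f (v ω) (y ω) ω)

/-- `l̲(x,y,ω) = sup_v {x·v − f*(v,y,ω)}`. -/
def lagrLow (f : Vec nt → (Fin m → ℝ) → Ω → EReal) (x : Vec nt) (y : Fin m → ℝ)
    (ω : Ω) : EReal :=
  ⨆ v : Vec nt, (((dotN nt x v : ℝ) : EReal) - fconj f v y ω)

/-- `El̲(x,y)`. -/
def intLlow (P : Measure Ω) (f : Vec nt → (Fin m → ℝ) → Ω → EReal)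
    (x : Ω → Vec nt) (y : Ω → Fin m → ℝ) : EReal :=
  EE P (fun ω => lagrLow f (x ω) (y ω) ω)

/-- `dom₁ Ef = {x ∈ 𝓝 : Ef(x,u) < +∞ for some u ∈ 𝓤}`. -/
def dom1intF (P : Measure Ω) (f : Vec nt → (Fin m → ℝ) → Ω → EReal)
    (ℱ : Fin (T+1) → MeasurableSpace Ω) (𝓤 : Set (Ω → Fin m → ℝ)) :
    Set (Ω → Vec nt) :=
  {x | x ∈ Nspace nt ℱ ∧ ∃ u ∈ 𝓤, intF P f x u < ⊤}

/-- The algebraic closure of a convex set in a real vector space. -/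
def acl {A : Type} [AddCommGroup A] [Module ℝ A] (C : Set A) : Set A :=
  {x | ∃ z ∈ C, ∀ lam : ℝ, 0 < lam → lam ≤ 1 → ((1 - lam) • x + lam • z) ∈ C}

/-- Decomposability of a set of measurable functions. -/
def Decomposable (P : Measure Ω) (𝓤 : Set (Ω → Fin m → ℝ)) : Prop :=
  ∀ A : Set Ω, MeasurableSet A → ∀ u ∈ 𝓤, ∀ u' : Ω → Fin m → ℝ,
    Measurable u' → (∃ M : ℝ, ∀ᵐ ω ∂P, ‖u' ω‖ ≤ M) →
    (fun ω => A.indicator u ω + Aᶜ.indicator u' ω) ∈ 𝓤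

end

/-- The closure of a set of strategies with respect to the essential-supremum norm. -/
def clLinf {Ω : Type} [MeasurableSpace Ω] {T : ℕ} {nt : Fin (T+1) → ℕ}
    (P : Measure Ω) (C : Set (Ω → Vec nt)) : Set (Ω → Vec nt) :=
  {x | ∃ xs : ℕ → (Ω → Vec nt), (∀ n, xs n ∈ C) ∧
    Filter.Tendsto (fun n => eLpNorm (xs n - x) ⊤ P) Filter.atTop (nhds 0)}

open MeasureTheory Set Filter Topology in
theorem aux_open {b : ℕ → ℕ} {O : Set (ℕ → ℕ)} (hO : IsOpen O)
    (hK : Set.pi univ (fun i => Set.Iic (b i)) ⊆ O) :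
    ∃ k, {σ : ℕ → ℕ | ∀ i < k, σ i ≤ b i} ⊆ O := by
  by_contra! hcon
  simp only [not_subset] at hcon
  choose σ hσ hσO using hcon
  have hKc : IsCompact (Set.pi univ (fun i => Set.Iic (b i))) :=
    isCompact_univ_pi (fun i => (Set.finite_Iic (b i)).isCompact)
  obtain ⟨τ, hτ, θ, hθ, hlim⟩ := hKc.tendsto_subseq
    (x := fun k i => min (σ k i) (b i)) (fun k i _ => by simp)
  have h2 : Tendsto (fun k => σ (θ k)) atTop (𝓝 τ) := by
    rw [tendsto_pi_nhds] at hlim ⊢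
    intro i
    refine (hlim i).congr' ?_
    filter_upwards [eventually_gt_atTop i] with k hk
    have : i < θ k := lt_of_lt_of_le hk (hθ.le_apply)
    simp only [Function.comp]
    exact min_eq_left (hσ (θ k) i this)
  have := h2.eventually (hO.mem_nhds (hK hτ))
  obtain ⟨k, hk⟩ := this.exists
  exact hσO _ hk

open MeasureTheory Set Filter Topology in
theorem aux_capacity {Z : Type} [TopologicalSpace Z] [T2Space Z] [MeasurableSpace Z]
    [BorelSpace Z] (μ : Measure Z) [IsFiniteMeasure μ] (p : (ℕ → ℕ) → Z) (hp : Continuous p)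
    (c : ENNReal) (hc : c < μ (range p)) :
    ∃ K : Set (ℕ → ℕ), IsCompact K ∧ c ≤ μ (p '' K) := by
  have step : ∀ (k : ℕ) (S : {S : Set (ℕ → ℕ) // c < μ (p '' S)}),
      ∃ N : ℕ, c < μ (p '' (S.1 ∩ {σ | σ k ≤ N})) := by
    rintro k ⟨S, hS⟩
    have hU : p '' S = ⋃ N : ℕ, p '' (S ∩ {σ | σ k ≤ N}) := by
      rw [← image_iUnion, ← inter_iUnion]
      congr 1
      ext σ
      simp only [mem_inter_iff, mem_iUnion, mem_ofPred_eq]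
      exact ⟨fun h => ⟨h, σ k, le_rfl⟩, fun h => h.1⟩
    have hm : Monotone fun N : ℕ => p '' (S ∩ {σ | σ k ≤ N}) := by
      intro a b hab
      apply image_mono
      apply inter_subset_inter_right
      intro σ (h : σ k ≤ a)
      exact h.trans hab
    rw [hU, hm.measure_iUnion] at hS
    exact lt_iSup_iff.1 hS
  choose N hN using step
  let F : ℕ → {S : Set (ℕ → ℕ) // c < μ (p '' S)} :=
    fun k => Nat.rec ⟨univ, by simpa using hc⟩
      (fun k S => ⟨S.1 ∩ {σ | σ k ≤ N k S}, hN k S⟩) k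
  let b : ℕ → ℕ := fun k => N k (F k)
  have hF : ∀ k, (F k).1 = {σ : ℕ → ℕ | ∀ i < k, σ i ≤ b i} := by
    intro k
    induction k with
    | zero => simp [F]
    | succ k ih =>
      have : (F (k+1)).1 = (F k).1 ∩ {σ | σ k ≤ b k} := rfl
      rw [this, ih]
      ext σ
      simp only [mem_inter_iff, mem_ofPred_eq, Nat.lt_succ_iff_lt_or_eq]
      constructor
      · rintro ⟨h1, h2⟩ i (hi | rfl)
        · exact h1 i hi
        · exact h2
      · intro h
        exact ⟨fun i hi => h i (Or.inl hi), h k (Or.inr rfl)⟩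
  refine ⟨Set.pi univ (fun i => Set.Iic (b i)),
    isCompact_univ_pi (fun i => (Set.finite_Iic (b i)).isCompact), ?_⟩
  set K := Set.pi univ (fun i => Set.Iic (b i)) with hKdef
  have hKc : IsCompact K := isCompact_univ_pi (fun i => (Set.finite_Iic (b i)).isCompact)
  have hsub : ⋂ k, closure (p '' (F k).1) ⊆ p '' K := by
    intro z hz
    by_contra hzK
    have hd : SeparatedNhds (p '' K) {z} :=
      SeparatedNhds.of_isCompact_isCompact (hKc.image hp) isCompact_singleton
        (by simpa using hzK)
    obtain ⟨U, V, hU, hV, hKU, hzV, hUV⟩ := hd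
    obtain ⟨k, hk⟩ := aux_open (b := b) (hU.preimage hp) (image_subset_iff.1 hKU)
    rw [mem_iInter] at hz
    have h1 := hz k
    rw [hF k, mem_closure_iff] at h1
    obtain ⟨w, hwV, hw⟩ := h1 V hV (hzV rfl)
    obtain ⟨σ, hσ, rfl⟩ := hw
    exact Set.disjoint_left.1 hUV (hk hσ) hwV
  refine le_trans ?_ (measure_mono hsub)
  have hanti : Antitone fun k => closure (p '' (F k).1) := by
    intro i j hij
    apply closure_mono
    apply image_mono
    rw [hF, hF]
    intro σ h l hl
    exact h l (hl.trans_le hij)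
  rw [hanti.measure_iInter (fun k => isClosed_closure.measurableSet.nullMeasurableSet)
    ⟨0, measure_ne_top _ _⟩]
  exact le_iInf fun k => (F k).2.le.trans (measure_mono subset_closure)

open MeasureTheory Set Filter Topology in
theorem aux_compact_sel {Z : Type} [TopologicalSpace Z] [T2Space Z] [MeasurableSpace Z]
    [BorelSpace Z] (R : Set (Z × ℝ)) (hR : IsCompact R) :
    ∃ s : Z → ℝ, Measurable s ∧ ∀ z ∈ Prod.fst '' R, (z, s z) ∈ R := by
  classical
  let S : Z → Set ℝ := fun z => {r | (z, r) ∈ R}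
  have hS : ∀ z, IsCompact (S z) := by
    intro z
    have : S z = Prod.snd '' (R ∩ (Prod.fst ⁻¹' {z})) := by
      ext r
      simp [S]
    rw [this]
    exact (hR.inter_right (isClosed_singleton.preimage continuous_fst)).image continuous_snd
  let D := Prod.fst '' R
  have hmem : ∀ z ∈ D, sInf (S z) ∈ S z := by
    rintro z ⟨⟨z', r⟩, h, rfl⟩
    exact (hS z').sInf_mem ⟨r, h⟩
  refine ⟨fun z => if z ∈ D then sInf (S z) else 0, ?_, ?_⟩
  · refine measurable_of_Iic fun c => ?_
    have hDm : MeasurableSet D := (hR.image continuous_fst).isClosed.measurableSet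
    have hE : MeasurableSet (Prod.fst '' (R ∩ Prod.snd ⁻¹' Iic c)) :=
      ((hR.inter_right (isClosed_Iic.preimage continuous_snd)).image
        continuous_fst).isClosed.measurableSet
    have : (fun z => if z ∈ D then sInf (S z) else 0) ⁻¹' Iic c =
        (Prod.fst '' (R ∩ Prod.snd ⁻¹' Iic c)) ∪ (Dᶜ ∩ {_z | (0:ℝ) ≤ c}) := by
      ext z
      by_cases hz : z ∈ D
      · simp only [mem_preimage, hz, if_true, mem_Iic, mem_union, mem_inter_iff, mem_compl_iff,
          not_true, false_and, or_false]
        constructor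
        · intro h
          exact ⟨(z, sInf (S z)), ⟨hmem z hz, h⟩, rfl⟩
        · rintro ⟨⟨z', r⟩, ⟨h1, h2⟩, rfl⟩
          exact (csInf_le (hS z').bddBelow h1).trans h2
      · have h3 : z ∉ Prod.fst '' (R ∩ Prod.snd ⁻¹' Iic c) :=
          fun h => hz (image_mono inter_subset_left h)
        simp only [mem_preimage, hz, if_false, mem_Iic, mem_union, h3, mem_inter_iff,
          mem_compl_iff, not_false_iff, true_and, false_or, mem_ofPred_eq]
    rw [this]
    exact hE.union (hDm.compl.inter (MeasurableSet.const _))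
  · intro z hz
    have : z ∈ D := hz
    simp only [this, if_true]
    exact hmem z hz

open MeasureTheory Set Filter Topology in
theorem aux_sel_approx {Z X : Type} [TopologicalSpace Z] [PolishSpace Z] [MeasurableSpace Z]
    [BorelSpace Z] [MeasurableSpace X] [StandardBorelSpace X] [Nonempty X]
    (μ : Measure Z) [IsFiniteMeasure μ] (G : Set (Z × X)) (hG : MeasurableSet G)
    (c : ENNReal) (hc : c < μ (Prod.fst '' G)) :
    ∃ (D : Set Z) (s : Z → X), MeasurableSet D ∧ Measurable s ∧ (∀ z ∈ D, (z, s z) ∈ G) ∧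
      c ≤ μ D := by
  obtain ⟨e, he⟩ := exists_measurableEmbedding_real X
  obtain ⟨e', he'm, he'⟩ := he.exists_measurable_extend measurable_id (fun _ => inferInstance)
  have he'' : ∀ x, e' (e x) = x := fun x => congrFun he' x
  have hm : MeasurableEmbedding (Prod.map id e : Z × X → Z × ℝ) :=
    MeasurableEmbedding.id.prodMap he
  have hA := (hm.measurableSet_image.2 hG).analyticSet
  rw [AnalyticSet_def] at hA
  rcases hA with hA | ⟨ψ, hψ, hr⟩
  · rw [image_eq_empty] at hA
    simp [hA] at hc
  · have hfst : Prod.fst '' G = range (Prod.fst ∘ ψ) := by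
      rw [range_comp, hr, image_image]; rfl
    rw [hfst] at hc
    obtain ⟨K, hK, hcK⟩ := aux_capacity μ _ (continuous_fst.comp hψ) c hc
    obtain ⟨s, hs, hsR⟩ := aux_compact_sel (ψ '' K) (hK.image hψ)
    refine ⟨Prod.fst ∘ ψ '' K, e' ∘ s,
      (hK.image (continuous_fst.comp hψ)).isClosed.measurableSet, he'm.comp hs, ?_, hcK⟩
    intro z hz
    rw [image_comp] at hz
    have h1 : (z, s z) ∈ Prod.map id e '' G := hr ▸ image_subset_range _ _ (hsR z hz)
    obtain ⟨⟨z', x⟩, hx, hxe⟩ := h1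
    simp only [Prod.map, id, Prod.mk.injEq] at hxe
    obtain ⟨rfl, h2⟩ := hxe
    simp only [Function.comp, ← h2, he'']
    exact hx

open MeasureTheory Set Filter Topology in
theorem aux_sel_ae {Z X : Type} [TopologicalSpace Z] [PolishSpace Z] [MeasurableSpace Z]
    [BorelSpace Z] [MeasurableSpace X] [StandardBorelSpace X] [Nonempty X]
    (μ : Measure Z) [IsFiniteMeasure μ] (G : Set (Z × X)) (hG : MeasurableSet G) :
    ∃ s : ℕ → Z → X, (∀ n, Measurable (s n)) ∧
      ∀ᵐ z ∂μ, (∃ x, (z, x) ∈ G) → ∃ n, (z, s n z) ∈ G := by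
  by_cases h0 : μ (Prod.fst '' G) = 0
  · refine ⟨fun _ _ => Classical.arbitrary X, fun _ => measurable_const, ?_⟩
    have := measure_eq_zero_iff_ae_notMem.1 h0
    filter_upwards [this] with z hz hx
    obtain ⟨x, hx⟩ := hx
    exact (hz ⟨(z, x), hx, rfl⟩).elim
  · have hlt : ∀ n : ℕ, μ (Prod.fst '' G) - ((n + 1 : ℕ) : ENNReal)⁻¹ < μ (Prod.fst '' G) := by
      intro n
      exact ENNReal.sub_lt_self (measure_ne_top _ _) h0 (by simp)
    choose D s hD hs hDs hμ using fun n => aux_sel_approx μ G hG _ (hlt n)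
    refine ⟨s, hs, ?_⟩
    have hDA : (⋃ n, D n) ⊆ Prod.fst '' G := by
      apply iUnion_subset
      intro n z hz
      exact ⟨_, hDs n z hz, rfl⟩
    have hle : μ (Prod.fst '' G) ≤ μ (⋃ n, D n) := by
      have h1 : ∀ n : ℕ, μ (Prod.fst '' G) ≤ μ (⋃ n, D n) + ((n + 1 : ℕ) : ENNReal)⁻¹ := by
        intro n
        rw [← tsub_le_iff_right]
        exact (hμ n).trans (measure_mono (subset_iUnion _ _))
      have h2 : Tendsto (fun n : ℕ => μ (⋃ n, D n) + ((n + 1 : ℕ) : ENNReal)⁻¹) atTop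
          (𝓝 (μ (⋃ n, D n) + 0)) :=
        tendsto_const_nhds.add
          (ENNReal.tendsto_inv_nat_nhds_zero.comp (tendsto_add_atTop_nat 1))
      rw [add_zero] at h2
      exact ge_of_tendsto' h2 h1
    have hnull : μ (Prod.fst '' G \ ⋃ n, D n) = 0 := by
      rw [measure_sdiff hDA (MeasurableSet.iUnion hD).nullMeasurableSet (measure_ne_top _ _)]
      exact tsub_eq_zero_of_le hle
    filter_upwards [measure_eq_zero_iff_ae_notMem.1 hnull] with z hz hx
    obtain ⟨x, hx⟩ := hx
    have : z ∈ ⋃ n, D n := by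
      by_contra hcon
      exact hz ⟨⟨(z, x), hx, rfl⟩, hcon⟩
    obtain ⟨n, hn⟩ := mem_iUnion.1 this
    exact ⟨n, hDs n z hn⟩

open MeasureTheory Set Filter Topology in
theorem aux_reduce {Ω X : Type} [MeasurableSpace Ω] [MeasurableSpace X] (G : Set (Ω × X))
    (hG : MeasurableSet G) :
    ∃ (g : Ω → (ℕ → Bool)) (G' : Set ((ℕ → Bool) × X)), Measurable g ∧ MeasurableSet G' ∧
      G = (fun p : Ω × X => (g p.1, p.2)) ⁻¹' G' := by
  classical
  rw [← generateFrom_prod] at hG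
  induction G, hG using MeasurableSpace.generateFrom_induction with
  | hC G hG _ =>
    obtain ⟨A, hA, B, hB, rfl⟩ := hG
    refine ⟨fun ω _ => decide (ω ∈ A), {p | p.1 0 = true ∧ p.2 ∈ B}, ?_, ?_, ?_⟩
    · refine measurable_pi_lambda _ fun _ => ?_
      exact measurable_to_bool (by simpa [preimage] using hA)
    · exact (measurableSet_eq_fun ((measurable_pi_apply 0).comp measurable_fst)
        measurable_const).inter (measurable_snd hB)
    · ext p; simp
  | empty => exact ⟨fun _ _ => true, ∅, measurable_const, MeasurableSet.empty, by simp⟩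
  | compl G _ ih =>
    obtain ⟨g, G', hg, hG', rfl⟩ := ih
    exact ⟨g, G'ᶜ, hg, hG'.compl, rfl⟩
  | iUnion G _ ih =>
    choose g G' hg hG' hGG using ih
    refine ⟨fun ω k => g k.unpair.1 ω k.unpair.2,
      ⋃ n, (fun q : (ℕ → Bool) × X => (fun j => q.1 (Nat.pair n j), q.2)) ⁻¹' G' n, ?_, ?_, ?_⟩
    · refine measurable_pi_lambda _ fun k => ?_
      exact (measurable_pi_apply _).comp (hg _)
    · refine MeasurableSet.iUnion fun n => ?_
      refine (Measurable.prodMk (measurable_pi_lambda _ fun j => ?_) measurable_snd) (hG' n)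
      exact (measurable_pi_apply _).comp measurable_fst
    · rw [preimage_iUnion]
      refine iUnion_congr fun n => ?_
      conv_lhs => rw [hGG n]
      ext p
      simp [Nat.unpair_pair]

open MeasureTheory Set Filter Topology in
theorem aux_sel_omega {Ω X : Type} [MeasurableSpace Ω] [MeasurableSpace X]
    [StandardBorelSpace X] [Nonempty X] (P : Measure Ω) [IsFiniteMeasure P]
    (G : Set (Ω × X)) (hG : MeasurableSet G) :
    ∃ s : ℕ → Ω → X, (∀ n, Measurable (s n)) ∧
      ∀ᵐ ω ∂P, (∃ x, (ω, x) ∈ G) → ∃ n, (ω, s n ω) ∈ G := by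
  obtain ⟨g, G', hg, hG', rfl⟩ := aux_reduce G hG
  have : PolishSpace Bool := inferInstance
  have : PolishSpace (ℕ → Bool) := inferInstance
  obtain ⟨s, hs, hae⟩ := aux_sel_ae (P.map g) G' hG'
  refine ⟨fun n => s n ∘ g, fun n => (hs n).comp hg, ?_⟩
  exact ae_of_ae_map hg.aemeasurable hae

open MeasureTheory Set Filter Topology in
theorem aux_inf_family {Ω X : Type} [MeasurableSpace Ω] [MeasurableSpace X]
    [StandardBorelSpace X] [Nonempty X] (P : Measure Ω) [IsFiniteMeasure P]
    (H : Ω × X → EReal) (hH : Measurable H) :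
    ∃ s : ℕ → Ω → X, (∀ n, Measurable (s n)) ∧
      ∀ᵐ ω ∂P, ⨅ n, H (ω, s n ω) = ⨅ x, H (ω, x) := by
  have h1 : ∀ q : ℚ, ∃ s : ℕ → Ω → X, (∀ n, Measurable (s n)) ∧
      ∀ᵐ ω ∂P, (∃ x, H (ω, x) < ((q : ℝ) : EReal)) →
        ∃ n, H (ω, s n ω) < ((q : ℝ) : EReal) := by
    intro q
    exact aux_sel_omega P {p | H p < ((q : ℝ) : EReal)} (measurableSet_lt hH measurable_const)
  choose s hs hae using h1
  obtain ⟨e, he⟩ := exists_surjective_nat (ℚ × ℕ)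
  refine ⟨fun n => s (e n).1 (e n).2, fun n => hs _ _, ?_⟩
  filter_upwards [ae_all_iff.2 hae] with ω hω
  refine le_antisymm ?_ (le_iInf fun n => iInf_le _ _)
  refine le_of_forall_gt fun c hc => ?_
  obtain ⟨q, hq1, hq2⟩ := EReal.exists_rat_btwn_of_lt hc
  obtain ⟨x, hx⟩ := iInf_lt_iff.1 hq1
  obtain ⟨n, hn⟩ := hω q ⟨x, hx⟩
  obtain ⟨k, hk⟩ := he (q, n)
  refine lt_of_le_of_lt (iInf_le _ k) ?_
  rw [hk]
  exact hn.trans hq2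

theorem epos_eq (a : EReal) : epos a = a.toENNReal := rfl

theorem EE_mono {Ω : Type} [MeasurableSpace Ω] (P : Measure Ω) {φ ψ : Ω → EReal}
    (h : ∀ᵐ ω ∂P, φ ω ≤ ψ ω) : EE P φ ≤ EE P ψ := by
  have h1 : ∫⁻ ω, epos (φ ω) ∂P ≤ ∫⁻ ω, epos (ψ ω) ∂P :=
    lintegral_mono_ae (h.mono fun ω hω => EReal.toENNReal_le_toENNReal hω)
  have h2 : ∫⁻ ω, epos (-ψ ω) ∂P ≤ ∫⁻ ω, epos (-φ ω) ∂P :=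
    lintegral_mono_ae (h.mono fun ω hω =>
      EReal.toENNReal_le_toENNReal (EReal.neg_le_neg_iff.2 hω))
  unfold EE
  by_cases hψ : ∫⁻ ω, epos (ψ ω) ∂P = ⊤
  · simp [hψ]
  · have hφ : ∫⁻ ω, epos (φ ω) ∂P ≠ ⊤ := ne_top_of_le_ne_top hψ h1
    rw [if_neg hψ, if_neg hφ]
    exact EReal.sub_le_sub (by exact_mod_cast h1) (by exact_mod_cast h2)

theorem EE_lt_top {Ω : Type} [MeasurableSpace Ω] (P : Measure Ω) {φ : Ω → EReal}
    (h : EE P φ < ⊤) : ∫⁻ ω, epos (φ ω) ∂P ≠ ⊤ := by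
  intro h'
  simp [EE, h'] at h

theorem epos_identity (a : EReal) (r : ℝ) :
    epos (a - (r : EReal)) + epos (-a) + ENNReal.ofReal r =
      epos a + epos (-(a - (r : EReal))) + ENNReal.ofReal (-r) := by
  simp only [epos_eq]
  induction a with
  | bot => simp
  | top => simp
  | coe x =>
    have e1 : ((x : EReal) - (r : EReal)) = ((x - r : ℝ) : EReal) := by norm_cast
    have e2 : (-(x : EReal)) = ((-x : ℝ) : EReal) := by norm_cast
    have e3 : (-((x - r : ℝ) : EReal)) = ((-(x - r) : ℝ) : EReal) := by norm_cast
    rw [e1, e2, e3]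
    simp only [EReal.toENNReal_of_ne_top (EReal.coe_ne_top _), EReal.toReal_coe]
    rw [← ENNReal.toReal_eq_toReal_iff' (by simp) (by simp)]
    rw [ENNReal.toReal_add (by simp) (by simp), ENNReal.toReal_add (by simp) (by simp),
      ENNReal.toReal_add (by simp) (by simp), ENNReal.toReal_add (by simp) (by simp)]
    simp only [ENNReal.toReal_ofReal']
    have key : ∀ t : ℝ, max t 0 = t + max (-t) 0 := by
      intro t
      rcases le_total t 0 with h | h
      · rw [max_eq_right h, max_eq_left (by linarith)]; ring
      · rw [max_eq_left h, max_eq_right (by linarith)]; ring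
    rw [key (x - r), key x, key r]
    ring

theorem EE_sub {Ω : Type} [MeasurableSpace Ω] (P : Measure Ω) {φ : Ω → EReal} {g : Ω → ℝ}
    (hφ : Measurable φ) (hgm : Measurable g) (hg : Integrable g P) :
    EE P (fun ω => φ ω - ((g ω : ℝ) : EReal)) = EE P φ - ((∫ ω, g ω ∂P : ℝ) : EReal) := by
  have hme : ∀ {χ : Ω → EReal}, Measurable χ → Measurable fun ω => epos (χ ω) :=
    fun h => h.ereal_toENNReal
  have hφg : Measurable fun ω => φ ω - ((g ω : ℝ) : EReal) := by
    simp only [sub_eq_add_neg]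
    exact hφ.add hgm.coe_real_ereal.neg
  have hp : ∫⁻ ω, ENNReal.ofReal (g ω) ∂P ≠ ⊤ := hg.lintegral_lt_top.ne
  have hn : ∫⁻ ω, ENNReal.ofReal (-g ω) ∂P ≠ ⊤ := hg.neg.lintegral_lt_top.ne
  have hint := integral_eq_lintegral_pos_part_sub_lintegral_neg_part hg
  have hid : (∫⁻ ω, epos (φ ω - ((g ω : ℝ) : EReal)) ∂P) + (∫⁻ ω, epos (-φ ω) ∂P) +
      ∫⁻ ω, ENNReal.ofReal (g ω) ∂P = (∫⁻ ω, epos (φ ω) ∂P) +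
      (∫⁻ ω, epos (-(φ ω - ((g ω : ℝ) : EReal))) ∂P) + ∫⁻ ω, ENNReal.ofReal (-g ω) ∂P := by
    rw [← lintegral_add_left (hme hφg),
      ← lintegral_add_right _ hgm.ennreal_ofReal, ← lintegral_add_left (hme hφ),
      ← lintegral_add_right _ (show Measurable fun ω => ENNReal.ofReal (-g ω) from
        hgm.neg.ennreal_ofReal)]
    exact lintegral_congr fun ω => epos_identity _ _
  have hle1 : (∫⁻ ω, epos (φ ω - ((g ω : ℝ) : EReal)) ∂P) ≤
      (∫⁻ ω, epos (φ ω) ∂P) + ∫⁻ ω, ENNReal.ofReal (-g ω) ∂P := by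
    rw [← lintegral_add_left (hme hφ)]
    refine lintegral_mono fun ω => ?_
    rw [sub_eq_add_neg]
    refine EReal.toENNReal_add_le.trans ?_
    rw [← EReal.coe_neg]
    simp [epos_eq, EReal.toENNReal_of_ne_top]
  have hle2 : (∫⁻ ω, epos (φ ω) ∂P) ≤
      (∫⁻ ω, epos (φ ω - ((g ω : ℝ) : EReal)) ∂P) + ∫⁻ ω, ENNReal.ofReal (g ω) ∂P := by
    rw [← lintegral_add_left (hme hφg)]
    refine lintegral_mono fun ω => ?_
    have : φ ω = (φ ω - ((g ω : ℝ) : EReal)) + ((g ω : ℝ) : EReal) := by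
      induction φ ω with
      | bot => simp
      | top => simp
      | coe x => norm_cast; ring
    conv_lhs => rw [this]
    refine EReal.toENNReal_add_le.trans ?_
    simp [epos_eq, EReal.toENNReal_of_ne_top]
  unfold EE
  generalize (∫⁻ ω, epos (φ ω - ((g ω : ℝ) : EReal)) ∂P) = A' at *
  generalize (∫⁻ ω, epos (φ ω) ∂P) = A at *
  generalize (∫⁻ ω, epos (-(φ ω - ((g ω : ℝ) : EReal))) ∂P) = B' at *
  generalize (∫⁻ ω, epos (-φ ω) ∂P) = B at *
  generalize ∫⁻ ω, ENNReal.ofReal (g ω) ∂P = p at *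
  generalize ∫⁻ ω, ENNReal.ofReal (-g ω) ∂P = n at *
  rw [hint]
  lift p to NNReal using hp
  lift n to NNReal using hn
  by_cases hA : A = ⊤
  · have hA' : A' = ⊤ := by
      by_contra hcon
      exact (ENNReal.add_ne_top.2 ⟨hcon, ENNReal.coe_ne_top⟩) (top_le_iff.1 (hA ▸ hle2))
    simp only [hA, hA', if_true]
    exact (EReal.top_sub_coe _).symm
  · have hA' : A' ≠ ⊤ := ne_top_of_le_ne_top (ENNReal.add_ne_top.2 ⟨hA, ENNReal.coe_ne_top⟩) hle1
    rw [if_neg hA, if_neg hA']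
    lift A to NNReal using hA
    lift A' to NNReal using hA'
    by_cases hB : B = ⊤
    · have hB' : B' = ⊤ := by
        by_contra hcon
        lift B' to NNReal using hcon
        rw [hB] at hid
        simp at hid
        exact absurd hid.symm (by norm_cast)
      subst hB hB'
      have : ∀ c : NNReal, (((c : ENNReal) : EReal) - ((⊤ : ENNReal) : EReal)) = ⊥ := by
        intro c
        simp
      rw [this, this]
      simp
    · have hB' : B' ≠ ⊤ := by
        intro hB'
        lift B to NNReal using hB
        rw [hB'] at hid
        simp at hid
      lift B to NNReal using hB
      lift B' to NNReal using hB'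
      have hid2 : (A' : ℝ) + B + p = A + B' + n := by exact_mod_cast hid
      have hc : ∀ c : NNReal, (((c : ENNReal) : EReal)) = ((c : ℝ) : EReal) := fun c => rfl
      simp only [hc, ENNReal.coe_toReal]
      norm_cast
      linarith

theorem EE_iInf_le {Ω : Type} [MeasurableSpace Ω] (P : Measure Ω) {φ : ℕ → Ω → EReal}
    (hφ : ∀ n, Measurable (φ n)) (hanti : Antitone φ) (h0 : EE P (φ 0) < ⊤) :
    ⨅ n, EE P (φ n) ≤ EE P (fun ω => ⨅ n, φ n ω) := by
  have hme : ∀ {χ : Ω → EReal}, Measurable χ → Measurable fun ω => epos (χ ω) :=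
    fun h => h.ereal_toENNReal
  have hlim : ∀ ω, Filter.Tendsto (fun n => φ n ω) Filter.atTop (nhds (⨅ n, φ n ω)) :=
    fun ω => tendsto_atTop_iInf fun i j hij => hanti hij ω
  have hfin := EE_lt_top P h0
  have t1 : Filter.Tendsto (fun n => ∫⁻ ω, epos (φ n ω) ∂P) Filter.atTop
      (nhds (∫⁻ ω, epos (⨅ n, φ n ω) ∂P)) := by
    refine lintegral_tendsto_of_tendsto_of_antitone (fun n => (hme (hφ n)).aemeasurable) ?_
      hfin ?_
    · exact Filter.Eventually.of_forall fun ω i j hij =>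
        EReal.toENNReal_le_toENNReal (hanti hij ω)
    · exact Filter.Eventually.of_forall fun ω =>
        (EReal.continuous_toENNReal.tendsto _).comp (hlim ω)
  have t2 : Filter.Tendsto (fun n => ∫⁻ ω, epos (-φ n ω) ∂P) Filter.atTop
      (nhds (∫⁻ ω, epos (-⨅ n, φ n ω) ∂P)) := by
    refine lintegral_tendsto_of_tendsto_of_monotone (fun n => (hme (hφ n).neg).aemeasurable) ?_ ?_
    · exact Filter.Eventually.of_forall fun ω i j hij =>
        EReal.toENNReal_le_toENNReal (EReal.neg_le_neg_iff.2 (hanti hij ω))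
    · exact Filter.Eventually.of_forall fun ω =>
        ((EReal.continuous_toENNReal.comp continuous_neg).tendsto _).comp (hlim ω)
  have hf1 : ∀ n, ∫⁻ ω, epos (φ n ω) ∂P ≠ ⊤ := fun n => ne_top_of_le_ne_top hfin
    (lintegral_mono fun ω => EReal.toENNReal_le_toENNReal (hanti (Nat.zero_le n) ω))
  have hf2 : ∫⁻ ω, epos (⨅ n, φ n ω) ∂P ≠ ⊤ := ne_top_of_le_ne_top hfin
    (lintegral_mono fun ω => EReal.toENNReal_le_toENNReal (iInf_le _ 0))
  have t3 : Filter.Tendsto (fun n => EE P (φ n)) Filter.atTop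
      (nhds (EE P (fun ω => ⨅ n, φ n ω))) := by
    unfold EE
    simp only [hf1, hf2, if_false, sub_eq_add_neg]
    have c1 := (continuous_coe_ennreal_ereal.tendsto _).comp t1
    have c2 := ((continuous_neg.comp continuous_coe_ennreal_ereal).tendsto _).comp t2
    have hc := EReal.continuousAt_add
      (p := (((∫⁻ ω, epos (⨅ n, φ n ω) ∂P : ENNReal) : EReal),
        -((∫⁻ ω, epos (-⨅ n, φ n ω) ∂P : ENNReal) : EReal)))
      (Or.inl (by simpa using hf2)) (Or.inl (EReal.coe_ennreal_ne_bot _))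
    exact hc.tendsto.comp (c1.prodMk_nhds c2)
  exact ge_of_tendsto' t3 fun n => iInf_le _ n

theorem ereal_sub_coe_lt_top {a : EReal} {r : ℝ} (h : a < ⊤) : a - (r : EReal) < ⊤ := by
  induction a with
  | bot => simp
  | top => exact absurd h (lt_irrefl _)
  | coe x => exact_mod_cast EReal.coe_lt_top (x - r)

theorem aux_interchange {Ω : Type} [MeasurableSpace Ω] (P : Measure Ω) [IsProbabilityMeasure P]
    {m : ℕ} (H : Ω × (Fin m → ℝ) → EReal) (hH : Measurable H)
    (𝓤 : Set (Ω → Fin m → ℝ)) (h𝓤meas : ∀ u ∈ 𝓤, Measurable u)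
    (h𝓤sub : ∀ u ∈ 𝓤, ∀ u' ∈ 𝓤, ∀ c : ℝ, u + u' ∈ 𝓤 ∧ c • u ∈ 𝓤)
    (h𝓤dec : Decomposable P 𝓤) (u0 : Ω → Fin m → ℝ) (hu0 : u0 ∈ 𝓤)
    (h0 : EE P (fun ω => H (ω, u0 ω)) < ⊤) :
    ⨅ u ∈ 𝓤, EE P (fun ω => H (ω, u ω)) ≤ EE P (fun ω => ⨅ v, H (ω, v)) := by
  classical
  obtain ⟨s, hs, hae⟩ := aux_inf_family P H hH
  have hHm : ∀ u ∈ 𝓤, Measurable fun ω => H (ω, u ω) := fun u hu =>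
    hH.comp (measurable_id.prodMk (h𝓤meas u hu))
  have hind : ∀ A : Set Ω, MeasurableSet A → ∀ u ∈ 𝓤, A.indicator u ∈ 𝓤 := by
    intro A hA u hu
    have := h𝓤dec A hA u hu (fun _ => 0) measurable_const ⟨0, by simp⟩
    convert this using 1
    funext ω
    by_cases h : ω ∈ A <;> simp [h]
  have hpiece : ∀ A : Set Ω, MeasurableSet A → ∀ u ∈ 𝓤, ∀ v ∈ 𝓤,
      (fun ω => if ω ∈ A then u ω else v ω) ∈ 𝓤 := by
    intro A hA u hu v hv
    have := (h𝓤sub _ (hind A hA u hu) _ (hind Aᶜ hA.compl v hv) 1).1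
    convert this using 1
    funext ω
    by_cases h : ω ∈ A <;> simp [h]
  -- truncated family
  have htr : ∀ n k : ℕ, (fun ω => if ‖s n ω‖ ≤ k then s n ω else u0 ω) ∈ 𝓤 := by
    intro n k
    have hA : MeasurableSet {ω | ‖s n ω‖ ≤ k} :=
      measurableSet_le (hs n).norm measurable_const
    have hb := h𝓤dec {ω | ‖s n ω‖ ≤ k}ᶜ hA.compl u0 hu0
      ({ω | ‖s n ω‖ ≤ k}.indicator (s n)) ((hs n).indicator hA) ⟨k, by
        refine Filter.Eventually.of_forall fun ω => ?_
        by_cases h : ‖s n ω‖ ≤ k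
        · simpa [Set.indicator, h] using h
        · simp [Set.indicator, h]⟩
    convert hb using 1
    funext ω
    by_cases h : ‖s n ω‖ ≤ k <;> simp [Set.indicator, h]
  let σ : ℕ → Ω → Fin m → ℝ := fun j ω =>
    if ‖s j.unpair.1 ω‖ ≤ (j.unpair.2 : ℕ) then s j.unpair.1 ω else u0 ω
  have hσ : ∀ j, σ j ∈ 𝓤 := fun j => htr _ _
  let stp : (Ω → Fin m → ℝ) → (Ω → Fin m → ℝ) → (Ω → Fin m → ℝ) := fun a b ω =>
    if ω ∈ {ω | H (ω, a ω) < H (ω, b ω)} then a ω else b ω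
  have hstp : ∀ a ∈ 𝓤, ∀ b ∈ 𝓤, stp a b ∈ 𝓤 := by
    intro a ha b hb
    convert hpiece _ (measurableSet_lt (hHm a ha) (hHm b hb)) a ha b hb using 1
    funext ω
    by_cases h : H (ω, a ω) < H (ω, b ω) <;> simp [stp, h]
  have hstpH : ∀ a b ω, H (ω, stp a b ω) = min (H (ω, a ω)) (H (ω, b ω)) := by
    intro a b ω
    by_cases h : H (ω, a ω) < H (ω, b ω)
    · simp [stp, h, h.le]
    · simp [stp, h, not_lt.1 h]
  let w : ℕ → Ω → Fin m → ℝ := fun n => Nat.rec u0 (fun j b => stp (σ j) b) n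
  have hw : ∀ n, w n ∈ 𝓤 := by
    intro n
    induction n with
    | zero => exact hu0
    | succ j ih => exact hstp _ (hσ j) _ ih
  have hwS : ∀ j ω, H (ω, w (j+1) ω) = min (H (ω, σ j ω)) (H (ω, w j ω)) :=
    fun j ω => hstpH _ _ ω
  have hanti : Antitone fun n ω => H (ω, w n ω) :=
    antitone_nat_of_succ_le fun j ω => by
      rw [hwS]; exact min_le_right _ _
  have hmain := EE_iInf_le P (φ := fun n ω => H (ω, w n ω)) (fun n => hHm _ (hw n)) hanti h0
  refine le_trans (le_iInf fun n => iInf₂_le (w n) (hw n)) (hmain.trans (EE_mono P ?_))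
  filter_upwards [hae] with ω hω
  rw [← hω]
  refine le_iInf fun n => ?_
  obtain ⟨k, hk⟩ := exists_nat_ge ‖s n ω‖
  refine (iInf_le _ (Nat.pair n k + 1)).trans ?_
  rw [hwS]
  refine (min_le_left _ _).trans (le_of_eq ?_)
  simp [σ, hk]

/-- if `{x ∈ 𝓝^∞ : El(x,y) < ∞}` is contained in the `L^∞`-norm closure of
`dom₁Ef ∩ 𝓝^∞` and `El(·,y)` is upper semicontinuous on that closure with respect to the
essential-supremum norm, then `φ̃*(y) = −inf_{x∈𝓝^∞} El(x,y)`. -/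
theorem stmt_18
    {Ω : Type} [mΩ : MeasurableSpace Ω] (P : Measure Ω) [IsProbabilityMeasure P]
    {T : ℕ} (ℱ : Fin (T+1) → MeasurableSpace Ω)
    (hℱ_le : ∀ t, ℱ t ≤ mΩ) (hℱ_mono : Monotone ℱ)
    (nt : Fin (T+1) → ℕ) {m : ℕ}
    -- `f` is a convex normal integrand
    (f : Vec nt → (Fin m → ℝ) → Ω → EReal)
    (hf_meas : Measurable (fun p : (Vec nt × (Fin m → ℝ)) × Ω => f p.1.1 p.1.2 p.2))
    (hf_proper : ∀ ω, (∀ x u, f x u ω ≠ ⊥) ∧ ∃ x u, f x u ω ≠ ⊤)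
    (hf_lsc : ∀ ω, LowerSemicontinuous (fun p : Vec nt × (Fin m → ℝ) => f p.1 p.2 ω))
    (hf_convex : ∀ (ω : Ω) (a b : ℝ) (x₁ x₂ : Vec nt) (u₁ u₂ : Fin m → ℝ),
      0 < a → 0 < b → a + b = 1 →
      f (a • x₁ + b • x₂) (a • u₁ + b • u₂) ω ≤
        (a : EReal) * f x₁ u₁ ω + (b : EReal) * f x₂ u₂ ω)
    -- `𝓤` and `𝓨` are decomposable subspaces of `L⁰` in separating duality
    (𝓤 𝓨 : Set (Ω → Fin m → ℝ))
    (h𝓤meas : ∀ u ∈ 𝓤, Measurable u) (h𝓨meas : ∀ y ∈ 𝓨, Measurable y)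
    (h𝓤sub : ∀ u ∈ 𝓤, ∀ u' ∈ 𝓤, ∀ c : ℝ, u + u' ∈ 𝓤 ∧ c • u ∈ 𝓤)
    (h𝓨sub : ∀ y ∈ 𝓨, ∀ y' ∈ 𝓨, ∀ c : ℝ, y + y' ∈ 𝓨 ∧ c • y ∈ 𝓨)
    (h𝓤dec : Decomposable P 𝓤) (h𝓨dec : Decomposable P 𝓨)
    (hpair : ∀ u ∈ 𝓤, ∀ y ∈ 𝓨, Integrable (fun ω => dotM (u ω) (y ω)) P)
    (hsep𝓤 : ∀ u ∈ 𝓤, (∀ y ∈ 𝓨, pairing P u y = 0) → u =ᵐ[P] (fun _ => 0))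
    (hsep𝓨 : ∀ y ∈ 𝓨, (∀ u ∈ 𝓤, pairing P u y = 0) → y =ᵐ[P] (fun _ => 0))
    (y : Ω → Fin m → ℝ) (hy : y ∈ 𝓨)
    (hdom : {x | x ∈ NspaceInf nt ℱ P ∧ intL P f x y < ⊤} ⊆
      clLinf P (dom1intF P f ℱ 𝓤 ∩ NspaceInf nt ℱ P))
    (husc : ∀ x ∈ clLinf P (dom1intF P f ℱ 𝓤 ∩ NspaceInf nt ℱ P),
      ∀ xs : ℕ → (Ω → Vec nt),
        (∀ n, xs n ∈ clLinf P (dom1intF P f ℱ 𝓤 ∩ NspaceInf nt ℱ P)) →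
        Filter.Tendsto (fun n => eLpNorm (xs n - x) ⊤ P) Filter.atTop (nhds 0) →
        Filter.limsup (fun n => intL P f (xs n) y) Filter.atTop ≤ intL P f x y) :
    conj P 𝓤 (valueFnInf P f ℱ) y = - ⨅ x ∈ NspaceInf nt ℱ P, intL P f x y := by
  have hxm : ∀ x ∈ NspaceInf nt ℱ P, Measurable x := by
    intro x hx
    exact measurable_pi_lambda _ fun t => (hx.1 t).mono (hℱ_le t) le_rfl
  have hdotm : ∀ {u v : Ω → Fin m → ℝ}, Measurable u → Measurable v →
      Measurable fun ω => dotM (u ω) (v ω) := by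
    intro u v hu hv
    unfold dotM
    exact Finset.measurable_sum _ fun j _ =>
      ((measurable_pi_apply j).comp hu).mul ((measurable_pi_apply j).comp hv)
  have hym := h𝓨meas y hy
  have hfm : ∀ x ∈ NspaceInf nt ℱ P, ∀ u ∈ 𝓤, Measurable fun ω => f (x ω) (u ω) ω := by
    intro x hx u hu
    exact hf_meas.comp (((hxm x hx).prodMk (h𝓤meas u hu)).prodMk measurable_id)
  have hEsub : ∀ x ∈ NspaceInf nt ℱ P, ∀ u ∈ 𝓤,
      EE P (fun ω => f (x ω) (u ω) ω - ((dotM (u ω) (y ω) : ℝ) : EReal)) =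
        intF P f x u - ((pairing P u y : ℝ) : EReal) := by
    intro x hx u hu
    exact EE_sub P (hfm x hx u hu) (hdotm (h𝓤meas u hu) hym) (hpair u hu y hy)
  -- weak inequality
  have hweak : ∀ x ∈ NspaceInf nt ℱ P, ∀ u ∈ 𝓤,
      intL P f x y ≤ intF P f x u - ((pairing P u y : ℝ) : EReal) := by
    intro x hx u hu
    rw [← hEsub x hx u hu]
    exact EE_mono P (Filter.Eventually.of_forall fun ω => iInf_le _ (u ω))
  -- interchange
  have hinter : ∀ x ∈ NspaceInf nt ℱ P, x ∈ dom1intF P f ℱ 𝓤 →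
      ⨅ u ∈ 𝓤, (intF P f x u - ((pairing P u y : ℝ) : EReal)) ≤ intL P f x y := by
    rintro x hx ⟨_, u0, hu0, hlt⟩
    have hH : Measurable fun q : Ω × (Fin m → ℝ) =>
        f (x q.1) q.2 q.1 - ((dotM q.2 (y q.1) : ℝ) : EReal) := by
      simp only [sub_eq_add_neg]
      refine (hf_meas.comp ((((hxm x hx).comp measurable_fst).prodMk measurable_snd).prodMk
        measurable_fst)).add (Measurable.coe_real_ereal ?_).neg
      unfold dotM
      exact Finset.measurable_sum _ fun j _ =>
        ((measurable_pi_apply j).comp measurable_snd).mul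
          ((measurable_pi_apply j).comp (hym.comp measurable_fst))
    have h0 : EE P (fun ω => f (x ω) (u0 ω) ω - ((dotM (u0 ω) (y ω) : ℝ) : EReal)) < ⊤ := by
      rw [hEsub x hx u0 hu0]
      exact ereal_sub_coe_lt_top hlt
    have := aux_interchange P _ hH 𝓤 h𝓤meas h𝓤sub h𝓤dec u0 hu0 h0
    refine le_trans (le_of_eq ?_) this
    exact iInf_congr fun u => iInf_congr fun hu => (hEsub x hx u hu).symm
  have hswap : ∀ (a : ℝ) (b : EReal), (a : EReal) - b = -(b - (a : EReal)) := by
    intro a b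
    rw [EReal.neg_sub (Or.inr (EReal.coe_ne_bot a)) (Or.inr (EReal.coe_ne_top a)), add_comm,
      sub_eq_add_neg]
  apply le_antisymm
  · unfold conj
    refine iSup₂_le fun u hu => ?_
    rw [hswap]
    refine EReal.neg_le_neg_iff.2 ?_
    unfold valueFnInf
    rw [EReal.le_sub_iff_add_le (Or.inl (EReal.coe_ne_bot _)) (Or.inl (EReal.coe_ne_top _))]
    refine le_iInf₂ fun x hx => ?_
    rw [← EReal.le_sub_iff_add_le (Or.inl (EReal.coe_ne_bot _)) (Or.inl (EReal.coe_ne_top _))]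
    exact (iInf₂_le x hx).trans (hweak x hx u hu)
  · rw [EReal.neg_le]
    have hC : ∀ x ∈ dom1intF P f ℱ 𝓤 ∩ NspaceInf nt ℱ P,
        - conj P 𝓤 (valueFnInf P f ℱ) y ≤ intL P f x y := by
      rintro x ⟨hx1, hx⟩
      refine le_trans ?_ (hinter x hx hx1)
      refine le_iInf₂ fun u hu => ?_
      rw [EReal.neg_le, ← hswap]
      unfold conj
      refine le_trans ?_ (le_iSup₂ u hu)
      exact EReal.sub_le_sub le_rfl (iInf₂_le x hx)
    refine le_iInf₂ fun x hx => ?_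
    by_cases htop : intL P f x y = ⊤
    · rw [htop]; exact le_top
    have hcl := hdom ⟨hx, lt_top_iff_ne_top.2 htop⟩
    obtain ⟨xs, hxs, hlim⟩ := id hcl
    refine le_trans ?_ (husc x hcl xs (fun n => ⟨fun _ => xs n, fun _ => hxs n, by simp⟩) hlim)
    refine le_trans ?_ (Filter.liminf_le_limsup)
    exact Filter.le_liminf_of_le (by isBoundedDefault)
      (Filter.Eventually.of_forall fun n => hC _ (hxs n))
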